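/- For any probability mass function P_X on a finite or countably infinite alphabet 𝒳 and any optimal compressor f*, the pointwise bound ℓ(f*(x)) ≤ ι_X(x) holds for every x ∈ 𝒳 with P_X(x) > 0, where ι_X(x) = log₂(1/P_X(x)). -/

import Mathlib

open scoped BigOperators

/-- The information function `ι_X(x) = log₂(1/P(x))` (in bits). -/
noncomputable def info {α : Type*} (P : α → ℝ) (x : α) : ℝ := Real.logb 2 (1 / P x)

/-- `g` is an optimal fixed-to-variable compressor for the pmf `P`: it is injective and there
is a ranking of the alphabet by decreasing probability (ranks forming an initial segment of
`ℕ`) such that the element of rank `m` receives the `(m+1)`-st binary string in the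
lexicographic order `∅,0,1,00,01,…`, i.e. a string of length `⌊log₂ (m+1)⌋`. -/
def IsOptimalCode {α : Type*} (P : α → ℝ) (g : α → List Bool) : Prop :=
  Function.Injective g ∧
  ∃ rank : α → ℕ,
    Function.Injective rank ∧
    (∀ x m, m ≤ rank x → ∃ y, rank y = m) ∧
    (∀ x y, rank x ≤ rank y → P y ≤ P x) ∧
    (∀ x, (g x).length = Nat.log 2 (rank x + 1))

/-- In a ranking of the alphabet by decreasing probability, the letter `x` and the `rank x`
letters ranked before it are all at least as likely as `x`, so `(rank x + 1) * P x ≤ 1`. -/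
theorem rank_add_one_mul_le_one {α : Type*} {P : α → ℝ} (hP0 : ∀ x, 0 ≤ P x)
    (hP1 : ∑' x, P x = 1) {rank : α → ℕ} (hseg : ∀ x m, m ≤ rank x → ∃ y, rank y = m)
    (hanti : ∀ x y, rank x ≤ rank y → P y ≤ P x) (x : α) :
    ((rank x + 1 : ℕ) : ℝ) * P x ≤ 1 := by
  have hsum : Summable P := by
    by_contra h
    simp [tsum_eq_zero_of_not_summable h] at hP1
  choose y hy using fun i : Fin (rank x + 1) => hseg x i (Nat.lt_succ_iff.mp i.isLt)
  have hyinj : Function.Injective y := fun i j hij =>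
    Fin.ext <| by rw [← hy i, ← hy j, hij]
  calc ((rank x + 1 : ℕ) : ℝ) * P x = ∑ _i : Fin (rank x + 1), P x := by simp
    _ ≤ ∑ i, P (y i) := Finset.sum_le_sum fun i _ =>
        hanti _ _ <| (hy i).trans_le (Nat.lt_succ_iff.mp i.isLt)
    _ = ∑ z ∈ Finset.univ.map ⟨y, hyinj⟩, P z := by simp
    _ ≤ ∑' z, P z := hsum.sum_le_tsum _ fun z _ => hP0 z
    _ = 1 := hP1

/-- Pointwise bound: the optimal codelengths never exceed the information,
`ℓ(g(x)) ≤ ι_X(x)` for every `x` of positive probability. -/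
theorem optimal_code_length_le_info
    {𝒳 : Type*} [Countable 𝒳] (P : 𝒳 → ℝ)
    (hP0 : ∀ x, 0 ≤ P x) (hP1 : ∑' x, P x = 1)
    (g : 𝒳 → List Bool) (hg : IsOptimalCode P g)
    (x : 𝒳) (hx : 0 < P x) :
    ((g x).length : ℝ) ≤ info P x := by
  obtain ⟨-, rank, -, hseg, hanti, hlen⟩ := hg
  have hpow : (2 : ℝ) ^ Nat.log 2 (rank x + 1) ≤ ((rank x + 1 : ℕ) : ℝ) := by
    exact_mod_cast Nat.pow_log_le_self 2 (Nat.succ_ne_zero (rank x))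
  rw [hlen x, info, Real.le_logb_iff_rpow_le one_lt_two (one_div_pos.mpr hx),
    Real.rpow_natCast, le_div_iff₀ hx]
  exact (mul_le_mul_of_nonneg_right hpow hx.le).trans
    (rank_add_one_mul_le_one hP0 hP1 hseg hanti x)
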